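/- Let K be the attractor of an IFS of similitudes on a complete metric space, endowed with its natural fractal structure. If the order of the natural fractal structure is finite, i.e., there is N ∈ ℕ such that for every n ∈ ℕ and every x ∈ K the number of words 𝐢 ∈ Σ^n with x ∈ A_𝐢 is at most N, then the natural fractal structure is irreducible. -/

import Mathlib

open scoped ENNReal

namespace IFSMoran

variable {X : Type*} [MetricSpace X]

/-- The map `f_i = f_{i1} o ... o f_{in}` associated to a word `i = i1...in`
(a list of indices). -/
def wMap {k : ℕ} (f : Fin k → X → X) : List (Fin k) → X → X
  | [] => id
  | i :: w => f i ∘ wMap f w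

/-- The piece `A_i = f_i(K)` of the natural fractal structure. -/
def piece {k : ℕ} (f : Fin k → X → X) (K : Set X) (w : List (Fin k)) : Set X :=
  wMap f w '' K

/-- The natural fractal structure (levels indexed by words) is irreducible:
no level admits a proper subcovering. -/
def Irred {k : ℕ} (f : Fin k → X → X) (K : Set X) : Prop :=
  ∀ w : List (Fin k),
    ¬ piece f K w ⊆ ⋃ v ∈ {v : List (Fin k) | v.length = w.length ∧ v ≠ w}, piece f K v

/-- `H³ₙˢ(K) = inf_{l ≥ n} ∑_{i ∈ Σˡ} diam (A_i) ^ s`. -/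
noncomputable def H3n {k : ℕ} (f : Fin k → X → X) (K : Set X) (s : ℝ) (n : ℕ) : ℝ≥0∞ :=
  ⨅ (l : ℕ) (_ : n ≤ l),
    ∑ w : Fin l → Fin k, EMetric.diam (piece f K (List.ofFn w)) ^ s

/-- `H³ˢ(K) = lim_n H³ₙˢ(K)`; the sequence is nondecreasing in `n`, so the limit
is the supremum. -/
noncomputable def H3 {k : ℕ} (f : Fin k → X → X) (K : Set X) (s : ℝ) : ℝ≥0∞ :=
  ⨆ n, H3n f K s n

/-- Fractal dimension III: `dim³(K) = inf {s ≥ 0 : H³ˢ(K) = 0}`. -/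
noncomputable def dim3 {k : ℕ} (f : Fin k → X → X) (K : Set X) : ℝ :=
  sInf {s : ℝ | 0 ≤ s ∧ H3 f K s = 0}

/-- `H⁴ₙˢ(K)`: infimum of `∑ diam (A_i) ^ s` over finite coverings of `K` by
pieces indexed by words of length `≥ n`. -/
noncomputable def H4n {k : ℕ} (f : Fin k → X → X) (K : Set X) (s : ℝ) (n : ℕ) : ℝ≥0∞ :=
  ⨅ (𝒜 : Finset (List (Fin k))) (_ : ∀ w ∈ 𝒜, n ≤ w.length)
      (_ : K ⊆ ⋃ w ∈ 𝒜, piece f K w),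
    ∑ w ∈ 𝒜, EMetric.diam (piece f K w) ^ s

/-- `H⁴ˢ(K) = lim_n H⁴ₙˢ(K)`; the sequence is nondecreasing in `n`, so the limit
is the supremum. -/
noncomputable def H4 {k : ℕ} (f : Fin k → X → X) (K : Set X) (s : ℝ) : ℝ≥0∞ :=
  ⨆ n, H4n f K s n

/-- Fractal dimension IV: `dim⁴(K) = inf {s ≥ 0 : H⁴ˢ(K) = 0}`. -/
noncomputable def dim4 {k : ℕ} (f : Fin k → X → X) (K : Set X) : ℝ :=
  sInf {s : ℝ | 0 ≤ s ∧ H4 f K s = 0}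

/-- Interior of `A` relative to `K` (as a subset of the ambient space `X`). -/
def intK (K A : Set X) : Set X := K \ closure (K \ A)

/-- The level separation property: interiors (in `K`) of two pieces indexed by
distinct words of the same length are disjoint (LSP1), and every piece has
nonempty interior in `K` (LSP2). -/
def LSP {k : ℕ} (f : Fin k → X → X) (K : Set X) : Prop :=
  (∀ v w : List (Fin k), v.length = w.length → v ≠ w →
      intK K (piece f K v) ∩ intK K (piece f K w) = ∅) ∧
  ∀ w : List (Fin k), (intK K (piece f K w)).Nonempty

/-- The natural fractal structure is a tiling: pieces indexed by distinct words
of the same length have disjoint interiors in `K`, and every piece is regularly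
closed in `K`, i.e. `cl_K (int_K (A_i)) = A_i`. -/
def IsTiling {k : ℕ} (f : Fin k → X → X) (K : Set X) : Prop :=
  (∀ v w : List (Fin k), v.length = w.length → v ≠ w →
      intK K (piece f K v) ∩ intK K (piece f K w) = ∅) ∧
  ∀ w : List (Fin k), closure (intK K (piece f K w)) ∩ K = piece f K w


theorem wMap_append {X : Type*} {k : ℕ} (f : Fin k → X → X) (v u : List (Fin k)) (x : X) :
    wMap f (v ++ u) x = wMap f v (wMap f u x) := by
  induction v with
  | nil => rfl
  | cons i v ih => simp [wMap, ih]

theorem mem_piece_append {X : Type*} {k : ℕ} {f : Fin k → X → X} {K : Set X}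
    {u : List (Fin k)} {x : X} (v : List (Fin k)) (hx : x ∈ piece f K u) :
    wMap f v x ∈ piece f K (v ++ u) := by
  obtain ⟨y, hy, rfl⟩ := hx
  exact ⟨y, hy, wMap_append f v u y⟩

theorem exists_mem_piece {X : Type*} {k : ℕ} {f : Fin k → X → X} {K : Set X}
    (hK : K ⊆ ⋃ i, f i '' K) (n : ℕ) {x : X} (hx : x ∈ K) :
    ∃ u : List (Fin k), u.length = n ∧ x ∈ piece f K u := by
  induction n generalizing x with
  | zero => exact ⟨[], rfl, x, hx, rfl⟩
  | succ n ih =>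
    obtain ⟨i, y, hy, rfl⟩ := Set.mem_iUnion.1 (hK hx)
    obtain ⟨u, hu, hyu⟩ := ih hy
    exact ⟨i :: u, by simp [hu], mem_piece_append [i] hyu⟩

theorem piece_subset {X : Type*} {k : ℕ} {f : Fin k → X → X} {K : Set X} (hK : ⋃ i, f i '' K ⊆ K)
    (w : List (Fin k)) : piece f K w ⊆ K := by
  induction w with
  | nil => simp [piece, wMap]
  | cons i w ih =>
    rintro _ ⟨y, hy, rfl⟩
    exact hK (Set.mem_iUnion.2 ⟨i, _, ih ⟨y, hy, rfl⟩, rfl⟩)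

/-- If the piece of `w` is covered by the other pieces of its level, then for every `m` some
point of `K` lies in at least `m + 1` pieces of level `m * w.length`: a point of the piece of
`w ⋯ w` (`m` times) also has codings that leave `w ⋯ w` at each of the `m` steps. -/
theorem exists_finset_words_of_subset {X : Type*} {k : ℕ} {f : Fin k → X → X} {K : Set X}
    (hKne : K.Nonempty) (hK : K = ⋃ i, f i '' K) {w : List (Fin k)}
    (hw : piece f K w ⊆
      ⋃ v ∈ {v : List (Fin k) | v.length = w.length ∧ v ≠ w}, piece f K v) (m : ℕ) :
    ∃ x ∈ K, ∃ T : Finset (List (Fin k)), T.card = m + 1 ∧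
      ∀ u ∈ T, u.length = m * w.length ∧ x ∈ piece f K u := by
  induction m with
  | zero =>
    obtain ⟨z, hz⟩ := hKne
    exact ⟨z, hz, {[]}, by simp, by simpa [piece, wMap] using hz⟩
  | succ m ih =>
    obtain ⟨x, hx, T, hT, hxT⟩ := ih
    have hxw : wMap f w x ∈ piece f K w := ⟨x, hx, rfl⟩
    obtain ⟨v, ⟨hvl, hvw⟩, y, hy, hyx⟩ := Set.mem_iUnion₂.1 (hw hxw)
    obtain ⟨u, hu, hyu⟩ := exists_mem_piece hK.subset (m * w.length) hy
    have hnot : v ++ u ∉ T.image (w ++ ·) := by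
      intro h
      obtain ⟨t, -, ht⟩ := Finset.mem_image.1 h
      exact hvw (List.append_inj_left ht hvl.symm).symm
    refine ⟨wMap f w x, piece_subset hK.symm.subset w hxw,
      insert (v ++ u) (T.image (w ++ ·)), ?_, ?_⟩
    · rw [Finset.card_insert_of_notMem hnot,
        Finset.card_image_of_injective _ (List.append_right_injective w), hT]
    · intro t ht
      rcases Finset.mem_insert.1 ht with rfl | ht
      · refine ⟨?_, hyx ▸ mem_piece_append v hyu⟩
        rw [List.length_append, hu, hvl]
        ring
      · obtain ⟨t, htT, rfl⟩ := Finset.mem_image.1 ht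
        refine ⟨?_, mem_piece_append w (hxT t htT).2⟩
        rw [List.length_append, (hxT t htT).1]
        ring

theorem stmt_15 {X : Type*} [MetricSpace X] [CompleteSpace X]
    {k : ℕ} (hk : 2 ≤ k) (f : Fin k → X → X) (c : Fin k → ℝ)
    (hc : ∀ i, c i ∈ Set.Ioo (0 : ℝ) 1)
    (hf : ∀ i x y, dist (f i x) (f i y) = c i * dist x y)
    (K : Set X) (hKne : K.Nonempty) (hKcp : IsCompact K)
    (hK : K = ⋃ i, f i '' K)
    (hord : ∃ N : ℕ, ∀ (n : ℕ) (x : X), x ∈ K →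
      Set.ncard {w : List (Fin k) | w.length = n ∧ x ∈ piece f K w} ≤ N) :
    Irred f K := by
  intro w hw
  obtain ⟨N, hN⟩ := hord
  obtain ⟨x, hx, T, hT, hxT⟩ := exists_finset_words_of_subset hKne hK hw N
  have hfin : {u : List (Fin k) | u.length = N * w.length ∧ x ∈ piece f K u}.Finite :=
    (List.finite_length_eq (Fin k) (N * w.length)).subset fun _ h => h.1
  have hle := Set.ncard_le_ncard (s := (T : Set (List (Fin k)))) hxT hfin
  rw [Set.ncard_coe_finset, hT] at hle
  exact absurd (hle.trans (hN (N * w.length) x hx)) (by omega)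

end IFSMoran
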